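/- arXiv:1112.5042 — 2 statements merged into one kernel-verified Lean document; each statement's English description precedes it below -/
import Mathlib

section
/- Nonpositivity of the reduced virial functional: for every continuously differentiable function ψ : [1,∞) → ℝ with ψ(1) = 0 that vanishes outside a compact set, one has Λ(ψ) := −(9/10) ∫₁^∞ ψ'(r)² r² dr + ∫₁^∞ ( sin²(ψ(r)) − (29/20) ψ(r) sin(2ψ(r)) ) dr ≤ 0. -/
open MeasureTheory Set

/-- Gluing two differentiable functions that agree to first order at `a`. -/
lemma hasDerivAt_ite_le {f g f' g' : ℝ → ℝ} {a : ℝ}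
    (hf : ∀ x, HasDerivAt f (f' x) x) (hg : ∀ x, HasDerivAt g (g' x) x)
    (h : f a = g a) (h' : f' a = g' a) (x : ℝ) :
    HasDerivAt (fun x => if x ≤ a then f x else g x) (if x ≤ a then f' x else g' x) x := by
  rcases lt_trichotomy x a with hx | rfl | hx
  · rw [if_pos hx.le]
    refine (hf x).congr_of_eventuallyEq ?_
    filter_upwards [Iio_mem_nhds hx] with y hy
    exact if_pos (le_of_lt hy)
  · rw [if_pos le_rfl, ← hasDerivWithinAt_univ, ← Iic_union_Ici (a := x)]
    refine HasDerivWithinAt.union ?_ ?_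
    · exact (hf x).hasDerivWithinAt.congr (fun y hy => if_pos hy) (if_pos le_rfl)
    · rw [h']
      refine (hg x).hasDerivWithinAt.congr (fun y hy => ?_) (by simp [h])
      rcases eq_or_lt_of_le (mem_Ici.1 hy) with rfl | hy
      · simp [h]
      · exact if_neg (not_le.2 hy)
  · rw [if_neg (not_le.2 hx)]
    refine (hg x).congr_of_eventuallyEq ?_
    filter_upwards [Ioi_mem_nhds hx] with y hy
    exact if_neg (not_le.2 hy)

lemma nonneg_of_hasDerivAt_nonneg {f f' : ℝ → ℝ} (hf : ∀ x, HasDerivAt f (f' x) x)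
    (h0 : 0 ≤ f 0) (hf' : ∀ x, 0 ≤ x → 0 ≤ f' x) {x : ℝ} (hx : 0 ≤ x) : 0 ≤ f x := by
  have hmono : MonotoneOn f (Ici 0) := by
    refine monotoneOn_of_deriv_nonneg (convex_Ici 0)
      (fun y _ => (hf y).continuousAt.continuousWithinAt)
      (fun y _ => (hf y).differentiableAt.differentiableWithinAt) fun y hy => ?_
    rw [interior_Ici] at hy
    rw [(hf y).deriv]
    exact hf' y (le_of_lt hy)
  exact h0.trans (hmono self_mem_Ici hx hx)

open Finset in
lemma hasDerivAt_sin_taylor (n : ℕ) (x : ℝ) :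
    HasDerivAt (fun x : ℝ => ∑ k ∈ range n, (-1) ^ k * x ^ (2 * k + 1) / ((2 * k + 1).factorial : ℝ))
      (∑ k ∈ range n, (-1) ^ k * x ^ (2 * k) / ((2 * k).factorial : ℝ)) x := by
  refine HasDerivAt.fun_sum fun k _ => ?_
  refine (((hasDerivAt_pow (2 * k + 1) x).const_mul ((-1) ^ k)).div_const _).congr_deriv ?_
  rw [Nat.factorial_succ]
  push_cast
  have := Nat.factorial_pos (2 * k)
  field_simp

open Finset in
lemma hasDerivAt_cos_taylor (n : ℕ) (x : ℝ) :
    HasDerivAt (fun x : ℝ => ∑ k ∈ range (n + 1), (-1) ^ k * x ^ (2 * k) / ((2 * k).factorial : ℝ))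
      (-∑ k ∈ range n, (-1) ^ k * x ^ (2 * k + 1) / ((2 * k + 1).factorial : ℝ)) x := by
  simp_rw [Finset.sum_range_succ', ← Finset.sum_neg_distrib]
  simp only [mul_zero, pow_zero]
  refine HasDerivAt.add_const _ (HasDerivAt.fun_sum fun k _ => ?_)
  refine (((hasDerivAt_pow (2 * (k + 1)) x).const_mul ((-1) ^ (k + 1))).div_const _).congr_deriv ?_
  rw [show 2 * (k + 1) = 2 * k + 1 + 1 by ring, Nat.factorial_succ (2 * k + 1)]
  push_cast
  have := Nat.factorial_pos (2 * k + 1)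
  field_simp
  ring

open Finset in
/-- The Taylor polynomials of `cos` and `sin` at `0` alternately over- and underestimate them. -/
lemma cos_sin_taylor_alternating (n : ℕ) :
    (∀ x : ℝ, 0 ≤ x → 0 ≤ (-1) ^ (n + 1) *
      (Real.cos x - ∑ k ∈ range (n + 1), (-1) ^ k * x ^ (2 * k) / ((2 * k).factorial : ℝ))) ∧
    (∀ x : ℝ, 0 ≤ x → 0 ≤ (-1) ^ (n + 1) *
      (Real.sin x -
        ∑ k ∈ range (n + 1), (-1) ^ k * x ^ (2 * k + 1) / ((2 * k + 1).factorial : ℝ))) := by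
  have key : ∀ n : ℕ, (∀ x : ℝ, 0 ≤ x → 0 ≤ (-1) ^ (n + 1) *
      (Real.cos x - ∑ k ∈ range (n + 1), (-1) ^ k * x ^ (2 * k) / ((2 * k).factorial : ℝ))) →
      ∀ x : ℝ, 0 ≤ x → 0 ≤ (-1) ^ (n + 1) * (Real.sin x -
        ∑ k ∈ range (n + 1), (-1) ^ k * x ^ (2 * k + 1) / ((2 * k + 1).factorial : ℝ)) := by
    intro n h x hx
    exact nonneg_of_hasDerivAt_nonneg (fun y =>
      ((Real.hasDerivAt_sin y).sub (hasDerivAt_sin_taylor (n + 1) y)).const_mul ((-1) ^ (n + 1)))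
      (by simp) h hx
  induction n with
  | zero =>
    have hcos : ∀ x : ℝ, 0 ≤ x → 0 ≤ (-1) ^ (0 + 1) * (Real.cos x -
        ∑ k ∈ range (0 + 1), (-1) ^ k * x ^ (2 * k) / ((2 * k).factorial : ℝ)) := by
      intro x _
      simp [Real.cos_le_one x]
    exact ⟨hcos, key 0 hcos⟩
  | succ n ih =>
    have hcos : ∀ x : ℝ, 0 ≤ x → 0 ≤ (-1) ^ (n + 1 + 1) * (Real.cos x -
        ∑ k ∈ range (n + 1 + 1), (-1) ^ k * x ^ (2 * k) / ((2 * k).factorial : ℝ)) := by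
      intro x hx
      refine nonneg_of_hasDerivAt_nonneg (fun y => ((Real.hasDerivAt_cos y).sub
        (hasDerivAt_cos_taylor (n + 1) y)).const_mul ((-1) ^ (n + 1 + 1)))
        (by simp [Finset.sum_range_succ']) (fun y hy => ?_) hx
      refine (ih.2 y hy).trans_eq ?_
      ring
    exact ⟨hcos, key (n + 1) hcos⟩

/-- A `C¹` even calibration: `17/10 p² - p⁴/6` on `[-2, 2]`, continued linearly. -/
noncomputable def calibration (p : ℝ) : ℝ :=
  if p ≤ -2 then 6 / 5 - 22 / 15 * p
  else if p ≤ 2 then 17 / 10 * p ^ 2 - p ^ 4 / 6 else 6 / 5 + 22 / 15 * p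

noncomputable def calibrationDeriv (p : ℝ) : ℝ :=
  if p ≤ -2 then -(22 / 15) else if p ≤ 2 then 17 / 5 * p - 2 / 3 * p ^ 3 else 22 / 15

lemma hasDerivAt_calibration (p : ℝ) : HasDerivAt calibration (calibrationDeriv p) p := by
  have hleft (x : ℝ) : HasDerivAt (fun p : ℝ => 6 / 5 - 22 / 15 * p) (-(22 / 15)) x := by
    simpa using ((hasDerivAt_id x).const_mul (22 / 15 : ℝ)).const_sub (6 / 5)
  have hmid (x : ℝ) : HasDerivAt (fun p : ℝ => 17 / 10 * p ^ 2 - p ^ 4 / 6)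
      (17 / 5 * x - 2 / 3 * x ^ 3) x := by
    refine (((hasDerivAt_pow 2 x).const_mul (17 / 10 : ℝ)).sub
      ((hasDerivAt_pow 4 x).div_const 6)).congr_deriv ?_
    norm_num
    ring
  have hright (x : ℝ) : HasDerivAt (fun p : ℝ => 6 / 5 + 22 / 15 * p) (22 / 15) x := by
    simpa using ((hasDerivAt_id x).const_mul (22 / 15 : ℝ)).const_add (6 / 5)
  exact hasDerivAt_ite_le hleft (hasDerivAt_ite_le hmid hright (by norm_num) (by norm_num))
    (by norm_num) (by norm_num) p

lemma continuous_calibrationDeriv : Continuous calibrationDeriv := by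
  refine Continuous.if_le (by fun_prop) (Continuous.if_le (by fun_prop) (by fun_prop)
    (by fun_prop) (by fun_prop) ?_) (by fun_prop) (by fun_prop) ?_
  all_goals
    rintro x rfl
    norm_num

lemma calibration_neg (p : ℝ) : calibration (-p) = calibration p := by
  unfold calibration
  rcases eq_or_ne p 2 with rfl | h2
  · norm_num
  rcases eq_or_ne p (-2) with rfl | h2'
  · norm_num
  split_ifs <;> first
    | ring1
    | (exfalso; linarith)
    | exact absurd (by linarith) h2
    | exact absurd (by linarith) h2'

lemma calibrationDeriv_neg (p : ℝ) : calibrationDeriv (-p) = -calibrationDeriv p := by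
  have h := (hasDerivAt_calibration (-p)).comp p (hasDerivAt_neg p)
  rw [show calibration ∘ Neg.neg = calibration from funext calibration_neg] at h
  linarith [h.unique (hasDerivAt_calibration p)]

lemma sin_sq_sub_le_of_two_le {p : ℝ} (hp : 2 ≤ p) :
    Real.sin p ^ 2 - 29 / 20 * p * Real.sin (2 * p) ≤ 11 / 20 + 29 / 20 * p := by
  have hcos : Real.sin p ^ 2 = 1 / 2 - Real.cos (2 * p) / 2 := by
    rw [Real.sin_sq_eq_half_sub]
  have h1 := Real.sin_sq_add_cos_sq (2 * p)
  have h : |-(Real.cos (2 * p) / 2) - 29 / 20 * p * Real.sin (2 * p)| ≤ 1 / 20 + 29 / 20 * p := by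
    refine abs_le_of_sq_le_sq ?_ (by linarith)
    nlinarith [sq_nonneg (29 / 20 * p * Real.cos (2 * p) - Real.sin (2 * p) / 2)]
  linarith [(abs_le.1 h).2]

/-- The stationary Hamilton–Jacobi inequality on `[0, 2]`. -/
lemma polynomial_calibration_ineq {p : ℝ} (hp0 : 0 ≤ p) (hp2 : p ≤ 2) :
    Real.sin p ^ 2 - 29 / 20 * p * Real.sin (2 * p) ≤
      17 / 10 * p ^ 2 - p ^ 4 / 6 - 5 / 18 * (17 / 5 * p - 2 / 3 * p ^ 3) ^ 2 := by
  have hcos := (cos_sin_taylor_alternating 5).1 (2 * p) (by linarith)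
  have hsin := (cos_sin_taylor_alternating 5).2 (2 * p) (by linarith)
  simp only [Finset.sum_range_succ, Finset.sum_range_zero, Nat.factorial] at hcos hsin
  norm_num at hcos hsin
  rw [Real.sin_sq_eq_half_sub]
  have hps := mul_le_mul_of_nonneg_left hsin hp0
  have hp4 : p ^ 2 ≤ 4 := by nlinarith
  rcases le_total (p ^ 2) 2 with h | h
  · have bernstein (k l : ℕ) : 0 ≤ p ^ 2 * ((p ^ 2) ^ k * (2 - p ^ 2) ^ l) :=
      mul_nonneg (sq_nonneg p) (mul_nonneg (by positivity) (pow_nonneg (by linarith) l))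
    linarith [bernstein 0 5, bernstein 1 4, bernstein 2 3, bernstein 3 2, bernstein 4 1,
      bernstein 5 0]
  · have bernstein (k l : ℕ) : 0 ≤ p ^ 2 * ((p ^ 2 - 2) ^ k * (4 - p ^ 2) ^ l) :=
      mul_nonneg (sq_nonneg p) (mul_nonneg (pow_nonneg (by linarith) k)
        (pow_nonneg (by linarith) l))
    linarith [bernstein 0 5, bernstein 1 4, bernstein 2 3, bernstein 3 2, bernstein 4 1,
      bernstein 5 0]

lemma calibration_ineq_of_nonneg {p : ℝ} (hp : 0 ≤ p) :
    Real.sin p ^ 2 - 29 / 20 * p * Real.sin (2 * p) ≤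
      calibration p - 5 / 18 * calibrationDeriv p ^ 2 := by
  unfold calibration calibrationDeriv
  have h2 : ¬p ≤ -2 := by linarith
  rw [if_neg h2, if_neg h2]
  by_cases h : p ≤ 2
  · rw [if_pos h, if_pos h]
    exact polynomial_calibration_ineq hp h
  · rw [if_neg h, if_neg h]
    have := sin_sq_sub_le_of_two_le (not_le.1 h).le
    linarith

lemma calibration_ineq (p : ℝ) :
    Real.sin p ^ 2 - 29 / 20 * p * Real.sin (2 * p) ≤
      calibration p - 5 / 18 * calibrationDeriv p ^ 2 := by
  rcases le_total 0 p with hp | hp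
  · exact calibration_ineq_of_nonneg hp
  · have := calibration_ineq_of_nonneg (neg_nonneg.2 hp)
    simpa [calibration_neg, calibrationDeriv_neg] using this

/-- Nonpositivity of the reduced virial functional `Λ`. -/
theorem reduced_virial_functional_nonpos
    (ψ ψ' : ℝ → ℝ)
    (hderiv : ∀ r ∈ Ici (1:ℝ), HasDerivWithinAt ψ (ψ' r) (Ici 1) r)
    (hcont : ContinuousOn ψ' (Ici 1))
    (hbc : ψ 1 = 0)
    (hsupp : ∃ R > (1:ℝ), ∀ r ≥ R, ψ r = 0) :
    -(9/10) * (∫ r in Ioi (1:ℝ), (ψ' r) ^ 2 * r ^ 2)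
      + (∫ r in Ioi (1:ℝ),
          (Real.sin (ψ r) ^ 2 - (29/20) * ψ r * Real.sin (2 * ψ r))) ≤ 0 := by
  obtain ⟨R, hR, hψR⟩ := hsupp
  have hψ'R : ∀ r, R < r → ψ' r = 0 := by
    intro r hr
    have h1 : HasDerivAt ψ (ψ' r) r :=
      (hderiv r (hR.trans hr).le).hasDerivAt (Ici_mem_nhds (hR.trans hr))
    have h2 : HasDerivAt ψ 0 r := by
      refine (hasDerivAt_const r (0 : ℝ)).congr_of_eventuallyEq ?_
      filter_upwards [Ioi_mem_nhds hr] with y hy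
      exact hψR y (le_of_lt hy)
    exact h1.unique h2
  have hψc : ContinuousOn ψ (Icc 1 R) := fun r hr =>
    (hderiv r hr.1).continuousWithinAt.mono Icc_subset_Ici_self
  have hψ'c : ContinuousOn ψ' (Icc 1 R) := hcont.mono Icc_subset_Ici_self
  have hcal : Continuous calibration :=
    continuous_iff_continuousAt.2 fun p => (hasDerivAt_calibration p).continuousAt
  have hcalψ : ContinuousOn (fun r => calibration (ψ r)) (Icc 1 R) :=
    hcal.comp_continuousOn hψc
  have hcal'ψ : ContinuousOn (fun r => calibrationDeriv (ψ r)) (Icc 1 R) :=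
    continuous_calibrationDeriv.comp_continuousOn hψc
  have toInterval : ∀ f : ℝ → ℝ, (∀ r, R < r → f r = 0) →
      ∫ r in Ioi (1:ℝ), f r = ∫ r in (1:ℝ)..R, f r := by
    intro f hf
    rw [intervalIntegral.integral_of_le hR.le]
    refine setIntegral_eq_of_subset_of_forall_sdiff_eq_zero measurableSet_Ioi
      Ioc_subset_Ioi_self fun r hr => hf r ?_
    by_contra! h
    exact hr.2 ⟨hr.1, h⟩
  have hint : ∀ f : ℝ → ℝ, ContinuousOn f (Icc 1 R) → IntervalIntegrable f volume 1 R :=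
    fun f hf => hf.intervalIntegrable_of_Icc hR.le
  have hkin := hint (fun r => ψ' r ^ 2 * r ^ 2) (by fun_prop)
  have hpot := hint (fun r => Real.sin (ψ r) ^ 2 - (29/20) * ψ r * Real.sin (2 * ψ r))
    (by fun_prop)
  have hflux := hint (fun r => calibration (ψ r) + r * (calibrationDeriv (ψ r) * ψ' r))
    (by fun_prop)
  have hcal0 : calibration 0 = 0 := by norm_num [calibration]
  have hfluxInt : ∫ r in (1:ℝ)..R,
      (calibration (ψ r) + r * (calibrationDeriv (ψ r) * ψ' r)) = 0 := by
    rw [intervalIntegral.integral_eq_sub_of_hasDerivAt_of_le (f := fun r => r * calibration (ψ r))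
      hR.le (by fun_prop) (fun r hr => ?_) hflux]
    · simp [hbc, hψR R le_rfl, hcal0]
    · have h1 : HasDerivAt ψ (ψ' r) r := (hderiv r hr.1.le).hasDerivAt (Ici_mem_nhds hr.1)
      refine ((hasDerivAt_id r).mul ((hasDerivAt_calibration (ψ r)).comp r h1)).congr_deriv ?_
      simp
  rw [toInterval _ fun r hr => by simp [hψ'R r hr],
    toInterval _ fun r hr => by simp [hψR r hr.le],
    ← intervalIntegral.integral_const_mul,
    ← intervalIntegral.integral_add (hkin.const_mul _) hpot, ← hfluxInt]
  refine intervalIntegral.integral_mono_on hR.le ((hkin.const_mul _).add hpot) hflux fun r _ => ?_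
  nlinarith [calibration_ineq (ψ r), sq_nonneg (9 / 5 * (ψ' r * r) + calibrationDeriv (ψ r))]
end

section
/- Location of the zero of the perturbed sine near π: let g(ζ) := (1/4) cos(2ζ) − (29/18) ζ sin(2ζ) and, for ε ∈ ℝ, h_ε(ζ) := sin(2ζ) − ε² g(ζ). Then for every ε ∈ [0, 7/20] there exists c ∈ [10, 40] such that h_ε( π + (ε²/8)(1 − (29/18)π ε² + c ε⁴) ) = 0. -/
open Set

/-- If `e = ε²` and `y = 2 (ζ - π)`, the perturbed sine is nonpositive for the parameter `c = 10`. -/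
lemma perturbed_sine_nonpos {e : ℝ} (he0 : 0 ≤ e) (he1 : e ≤ 49 / 400) {y : ℝ}
    (hy : y = e / 4 * (1 - 29 / 18 * Real.pi * e + 10 * e ^ 2)) :
    Real.sin y - e * (1 / 4 * Real.cos y - 29 / 18 * (Real.pi + y / 2) * Real.sin y) ≤ 0 := by
  obtain ⟨k, hk⟩ : ∃ k, k = 29 / 18 * Real.pi := ⟨_, rfl⟩
  have hk1 : 5.05 ≤ k := by linarith [Real.pi_gt_d2]
  have hk2 : k ≤ 5.08 := by linarith [Real.pi_lt_d2]
  obtain ⟨P, hP⟩ : ∃ P, P = 1 - k * e + 10 * e ^ 2 := ⟨_, rfl⟩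
  have hyP : y = e / 4 * P := by rw [hy, hP, hk]
  have hke : k * e ≤ 0.63 := by nlinarith
  have hP0 : 0 ≤ P := by nlinarith
  have hP1 : P ≤ 1 := by nlinarith
  have hy0 : 0 ≤ y := by rw [hyP]; positivity
  have hs := Real.sin_le hy0
  have hc := Real.one_sub_sq_div_two_le_cos (x := y)
  have hP2 : P ^ 2 ≤ 1 := by nlinarith
  have key : P * (1 + k * e) + e ^ 2 * P ^ 2 * (29 / 144 + 1 / 32) - 1 ≤ 0 := by
    have h1 : P * (1 + k * e) - 1 = e ^ 2 * (10 + 10 * (k * e) - k ^ 2) := by rw [hP]; ring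
    have h2 : 10 + 10 * (k * e) - k ^ 2 + P ^ 2 * (29 / 144 + 1 / 32) ≤ 0 := by nlinarith
    nlinarith [mul_nonneg (sq_nonneg e) (neg_nonneg.2 h2)]
  have hA : 0 ≤ 1 + e * (k + 29 / 36 * y) := by
    have : 0 ≤ k := by linarith
    positivity
  calc Real.sin y - e * (1 / 4 * Real.cos y - 29 / 18 * (Real.pi + y / 2) * Real.sin y)
      = Real.sin y * (1 + e * (k + 29 / 36 * y)) - e / 4 * Real.cos y := by rw [hk]; ring
    _ ≤ y * (1 + e * (k + 29 / 36 * y)) - e / 4 * (1 - y ^ 2 / 2) := by gcongr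
    _ = e / 4 * (P * (1 + k * e) + e ^ 2 * P ^ 2 * (29 / 144 + 1 / 32) - 1) := by
        rw [hyP]; ring
    _ ≤ 0 := mul_nonpos_of_nonneg_of_nonpos (by positivity) key

/-- If `e = ε²` and `y = 2 (ζ - π)`, the perturbed sine is nonnegative for the parameter `c = 40`. -/
lemma perturbed_sine_nonneg {e : ℝ} (he0 : 0 ≤ e) (he1 : e ≤ 49 / 400) {y : ℝ}
    (hy : y = e / 4 * (1 - 29 / 18 * Real.pi * e + 40 * e ^ 2)) :
    0 ≤ Real.sin y - e * (1 / 4 * Real.cos y - 29 / 18 * (Real.pi + y / 2) * Real.sin y) := by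
  obtain ⟨k, hk⟩ : ∃ k, k = 29 / 18 * Real.pi := ⟨_, rfl⟩
  have hk1 : 5.05 ≤ k := by linarith [Real.pi_gt_d2]
  have hk2 : k ≤ 5.08 := by linarith [Real.pi_lt_d2]
  obtain ⟨P, hP⟩ : ∃ P, P = 1 - k * e + 40 * e ^ 2 := ⟨_, rfl⟩
  have hyP : y = e / 4 * P := by rw [hy, hP, hk]
  have hke0 : 0 ≤ k * e := by nlinarith
  have hke : k * e ≤ 0.63 := by nlinarith
  have hP0 : 0 ≤ P := by nlinarith
  have hP1 : P ≤ 1 := by nlinarith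
  have hy0 : 0 ≤ y := by rw [hyP]; positivity
  have hy1 : y ≤ 1 := by rw [hyP]; nlinarith
  have hs : y - y ^ 3 / 4 ≤ Real.sin y := by
    rcases hy0.eq_or_lt with h | h
    · simp [← h]
    · linarith [Real.sin_gt_sub_cube h, pow_pos h 3]
  have hP2 : P ^ 2 ≤ 1 := by nlinarith
  have hPk : P * (1 + k * e) - 1 = e ^ 2 * (40 + 40 * (k * e) - k ^ 2) := by rw [hP]; ring
  have key : 0 ≤ P * (1 + k * e) * (1 - e ^ 2 * P ^ 2 / 64) - 1 := by
    have h1 : P * (1 + k * e) ≤ 2 := by nlinarith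
    have h2 : P * (1 + k * e) * P ^ 2 ≤ 2 := by nlinarith [mul_nonneg hP0 hke0]
    have h3 : 0 ≤ 40 + 40 * (k * e) - k ^ 2 - P * (1 + k * e) * P ^ 2 / 64 := by nlinarith
    nlinarith [mul_nonneg (sq_nonneg e) h3]
  have hsin : 0 ≤ y - y ^ 3 / 4 := by
    have : y ^ 3 ≤ y := pow_le_of_le_one hy0 hy1 three_ne_zero
    linarith
  calc (0 : ℝ) ≤ e / 4 * (P * (1 + k * e) * (1 - e ^ 2 * P ^ 2 / 64) - 1) :=
        mul_nonneg (by positivity) key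
    _ = (y - y ^ 3 / 4) * (1 + e * k) - e / 4 * 1 := by rw [hyP]; ring
    _ ≤ Real.sin y * (1 + e * (k + 29 / 36 * y)) - e / 4 * Real.cos y := by
        gcongr
        · exact hsin.trans hs
        · linarith
        · exact Real.cos_le_one y
    _ = Real.sin y - e * (1 / 4 * Real.cos y - 29 / 18 * (Real.pi + y / 2) * Real.sin y) := by
        rw [hk]; ring

/-- Location of the zero of `h_ε(ζ) = sin 2ζ − ε² g(ζ)` near `π`, with
`g(ζ) = (1/4) cos 2ζ − (29/18) ζ sin 2ζ`: it is at
`π + (ε²/8)(1 − (29/18)π ε² + c ε⁴)` for some `c ∈ [10, 40]`. -/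
theorem zero_near_pi_perturbed_sine :
    ∀ ε ∈ Icc (0:ℝ) (7/20), ∃ c ∈ Icc (10:ℝ) 40,
      Real.sin (2 * (Real.pi + (ε ^ 2 / 8) * (1 - (29/18) * Real.pi * ε ^ 2 + c * ε ^ 4)))
        - ε ^ 2 * ((1/4) * Real.cos (2 * (Real.pi
              + (ε ^ 2 / 8) * (1 - (29/18) * Real.pi * ε ^ 2 + c * ε ^ 4)))
            - (29/18) * (Real.pi + (ε ^ 2 / 8) * (1 - (29/18) * Real.pi * ε ^ 2 + c * ε ^ 4))
              * Real.sin (2 * (Real.pi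
                  + (ε ^ 2 / 8) * (1 - (29/18) * Real.pi * ε ^ 2 + c * ε ^ 4)))) = 0 := by
  rintro ε ⟨hε0, hε1⟩
  have he1 : ε ^ 2 ≤ 49 / 400 := by nlinarith
  have hcont : ContinuousOn (fun c : ℝ =>
      Real.sin (2 * (Real.pi + (ε ^ 2 / 8) * (1 - (29/18) * Real.pi * ε ^ 2 + c * ε ^ 4)))
        - ε ^ 2 * ((1/4) * Real.cos (2 * (Real.pi
              + (ε ^ 2 / 8) * (1 - (29/18) * Real.pi * ε ^ 2 + c * ε ^ 4)))
            - (29/18) * (Real.pi + (ε ^ 2 / 8) * (1 - (29/18) * Real.pi * ε ^ 2 + c * ε ^ 4))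
              * Real.sin (2 * (Real.pi
                  + (ε ^ 2 / 8) * (1 - (29/18) * Real.pi * ε ^ 2 + c * ε ^ 4))))) (Icc 10 40) := by
    fun_prop
  have hshift (x : ℝ) : 2 * (Real.pi + x) = 2 * x + 2 * Real.pi := by ring
  have hhalf (x : ℝ) : x = 2 * x / 2 := by ring
  refine intermediate_value_Icc (by norm_num) hcont ⟨?_, ?_⟩
  · have h := perturbed_sine_nonpos (sq_nonneg ε) he1
      (y := 2 * ((ε ^ 2 / 8) * (1 - (29/18) * Real.pi * ε ^ 2 + 10 * ε ^ 4))) (by ring)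
    simp only [hshift, Real.sin_add_two_pi, Real.cos_add_two_pi]
    rwa [← hhalf] at h
  · have h := perturbed_sine_nonneg (sq_nonneg ε) he1
      (y := 2 * ((ε ^ 2 / 8) * (1 - (29/18) * Real.pi * ε ^ 2 + 40 * ε ^ 4))) (by ring)
    simp only [hshift, Real.sin_add_two_pi, Real.cos_add_two_pi]
    rwa [← hhalf] at h
end
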